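/- arXiv:1107.4715 — 2 statements merged into one kernel-verified Lean document; each statement's English description precedes it below -/
import Mathlib

section
/- Let G be a graph on n vertices with maximum degree at most Δ and average degree d = 2e(G)/n, and let ℓ ≥ 1 be an integer. Then the number of paths of length ℓ in G is at least n·(d^ℓ − ℓ²·Δ^{ℓ−1}). -/
open SimpleGraph

/-- The number of paths of length `k` in `G`: ordered sequences of `k + 1`
pairwise distinct vertices in which consecutive vertices are adjacent. -/
noncomputable def pathCount {V : Type*} [Fintype V] (G : SimpleGraph V) (k : ℕ) : ℕ :=
  Set.ncard {f : Fin (k + 1) → V | Function.Injective f ∧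
    ∀ i : Fin k, G.Adj (f i.castSucc) (f i.succ)}

/-- Nondependent tail. -/
abbrev tl {V : Type*} {k : ℕ} (f : Fin (k + 1 + 1) → V) : Fin (k + 1) → V :=
  Fin.tail (α := fun _ => V) f

/-- Nondependent cons. -/
abbrev cn {V : Type*} {k : ℕ} (v : V) (f : Fin (k + 1) → V) : Fin (k + 1 + 1) → V :=
  Fin.cons (α := fun _ => V) v f

theorem cn_tl {V : Type*} {k : ℕ} (f : Fin (k + 1 + 1) → V) : cn (f 0) (tl f) = f :=
  Fin.cons_self_tail f

theorem cn_inj {V : Type*} {k : ℕ} (v : V) :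
    Function.Injective (cn v : (Fin (k + 1) → V) → Fin (k + 1 + 1) → V) :=
  Fin.cons_right_injective (α := fun _ => V) v

open Classical in
/-- Number of walks of length `k` starting at `v`, recursively, as a real number. -/
noncomputable def walkNum {V : Type*} [Fintype V] (G : SimpleGraph V) : ℕ → V → ℝ
  | 0, _ => 1
  | k + 1, v => ∑ u ∈ G.neighborFinset v, walkNum G k u

open Classical in
/-- The walks of length `k`. -/
noncomputable def walkSet {V : Type*} [Fintype V] (G : SimpleGraph V) (k : ℕ) :
    Finset (Fin (k + 1) → V) :=
  Finset.univ.filter fun f => ∀ i : Fin k, G.Adj (f i.castSucc) (f i.succ)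

open Classical in
/-- The non-injective walks of length `k`. -/
noncomputable def badSet {V : Type*} [Fintype V] (G : SimpleGraph V) (k : ℕ) :
    Finset (Fin (k + 1) → V) :=
  (walkSet G k).filter fun f => ¬ Function.Injective f

theorem mem_walkSet {V : Type*} [Fintype V] (G : SimpleGraph V) (k : ℕ) (f : Fin (k + 1) → V) :
    f ∈ walkSet G k ↔ ∀ i : Fin k, G.Adj (f i.castSucc) (f i.succ) := by
  simp [walkSet]

theorem mem_walkSet_succ {V : Type*} [Fintype V] (G : SimpleGraph V) (k : ℕ)
    (f : Fin (k + 1 + 1) → V) :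
    f ∈ walkSet G (k + 1) ↔ G.Adj (f 0) (tl f 0) ∧ tl f ∈ walkSet G k := by
  rw [mem_walkSet, mem_walkSet, Fin.forall_fin_succ]
  rfl

open Classical in
theorem walkNum_eq {V : Type*} [Fintype V] (G : SimpleGraph V) (k : ℕ) (v : V) :
    walkNum G k v = ((walkSet G k).filter fun f => f 0 = v).card := by
  induction k generalizing v with
  | zero =>
    have : ((walkSet G 0).filter fun f => f 0 = v) = {fun _ => v} := by
      ext f
      simp only [Finset.mem_filter, mem_walkSet, Finset.mem_singleton]
      constructor
      · rintro ⟨-, h⟩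
        funext i
        have hi : i = 0 := Fin.fin_one_eq_zero i
        rw [hi, h]
      · rintro rfl
        exact ⟨fun i => i.elim0, rfl⟩
    rw [this]; simp [walkNum]
  | succ k ih =>
    have : ((walkSet G (k + 1)).filter fun f => f 0 = v) =
        (G.neighborFinset v).biUnion fun u =>
          ((walkSet G k).filter fun f => f 0 = u).image (cn v) := by
      ext f
      simp only [Finset.mem_filter, mem_walkSet_succ, Finset.mem_biUnion, Finset.mem_image,
        mem_neighborFinset]
      constructor
      · rintro ⟨⟨h1, h2⟩, rfl⟩
        exact ⟨tl f 0, h1, tl f, ⟨h2, rfl⟩, cn_tl f⟩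
      · rintro ⟨u, hu, g, ⟨hg, rfl⟩, rfl⟩
        simp [hu, hg]
    rw [this, Finset.card_biUnion]
    · rw [walkNum]
      push_cast
      refine Finset.sum_congr rfl fun u _ => ?_
      rw [ih, Finset.card_image_of_injective _ (cn_inj _)]
    · intro a _ b _ hab
      rw [Function.onFun, Finset.disjoint_left]
      intro f hf hf'
      simp only [Finset.mem_filter, Finset.mem_image] at hf hf'
      obtain ⟨g, ⟨_, rfl⟩, rfl⟩ := hf
      obtain ⟨g', ⟨_, rfl⟩, h⟩ := hf'
      exact hab (by rw [cn_inj _ h])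

theorem walkSet_card {V : Type*} [Fintype V] (G : SimpleGraph V) (k : ℕ) :
    ((walkSet G k).card : ℝ) = ∑ v, walkNum G k v := by
  classical
  rw [Finset.card_eq_sum_card_fiberwise (f := fun f => f 0) (t := Finset.univ)
    (fun _ _ => by simp)]
  push_cast
  refine Finset.sum_congr rfl fun v _ => ?_
  rw [walkNum_eq]

open Classical in
theorem swap_sum {V : Type*} [Fintype V] (G : SimpleGraph V) (h : V → ℝ) :
    ∑ v, ∑ u ∈ G.neighborFinset v, h u = ∑ u, (G.degree u : ℝ) * h u := by
  rw [Finset.sum_comm' (t' := Finset.univ) (s' := fun u => G.neighborFinset u)]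
  · simp
  · intro x y; simp [G.adj_comm]

open Classical in
theorem walkNum_nonneg {V : Type*} [Fintype V] (G : SimpleGraph V) (k : ℕ) (v : V) :
    0 ≤ walkNum G k v := by
  rw [walkNum_eq]; positivity

open Classical in
theorem walkNum_pos {V : Type*} [Fintype V] (G : SimpleGraph V) (k : ℕ) (v : V)
    (hv : 0 < G.degree v) : 0 < walkNum G k v := by
  induction k generalizing v with
  | zero => simp [walkNum]
  | succ k ih =>
    rw [walkNum]
    apply Finset.sum_pos
    · intro u hu
      rw [mem_neighborFinset] at hu
      exact ih u ((G.degree_pos_iff_exists_adj u).2 ⟨v, hu.symm⟩)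
    · exact Finset.card_pos.1 hv

theorem log_tangent {x c : ℝ} (hx : 0 < x) (hc : 0 < c) :
    Real.log x ≤ Real.log c + x / c - 1 := by
  have := Real.log_le_sub_one_of_pos (div_pos hx hc)
  rw [Real.log_div hx.ne' hc.ne'] at this
  linarith

open Classical in
theorem log_step {V : Type*} [Fintype V] (G : SimpleGraph V) (k : ℕ) (v : V) :
    (G.degree v : ℝ) * Real.log (G.degree v) +
      ∑ u ∈ G.neighborFinset v, Real.log (walkNum G k u) ≤
    (G.degree v : ℝ) * Real.log (walkNum G (k + 1) v) := by
  rcases Nat.eq_zero_or_pos (G.degree v) with h | h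
  · have : G.neighborFinset v = ∅ := Finset.card_eq_zero.1 h
    simp [h, this]
  · have hW := walkNum_pos G (k + 1) v h
    have hd : (0 : ℝ) < G.degree v := by exact_mod_cast h
    have hle : ∑ u ∈ G.neighborFinset v, Real.log (walkNum G k u) ≤
        ∑ u ∈ G.neighborFinset v, (Real.log (walkNum G (k + 1) v / G.degree v) +
          walkNum G k u / (walkNum G (k + 1) v / G.degree v) - 1) := by
      refine Finset.sum_le_sum fun u hu => ?_
      rw [mem_neighborFinset] at hu
      exact log_tangent (walkNum_pos G k u ((G.degree_pos_iff_exists_adj u).2 ⟨v, hu.symm⟩))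
        (div_pos hW hd)
    rw [Finset.sum_sub_distrib, Finset.sum_add_distrib, ← Finset.sum_div, ← walkNum,
      Real.log_div hW.ne' hd.ne'] at hle
    simp only [Finset.sum_const, card_neighborFinset_eq_degree, nsmul_eq_mul] at hle
    have e : walkNum G (k + 1) v / (walkNum G (k + 1) v / G.degree v) = G.degree v := by
      field_simp
    rw [e] at hle
    linarith

open Classical in
theorem log_sum {V : Type*} [Fintype V] (G : SimpleGraph V) (k : ℕ) :
    (k : ℝ) * ∑ v, (G.degree v : ℝ) * Real.log (G.degree v) ≤
      ∑ v, (G.degree v : ℝ) * Real.log (walkNum G k v) := by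
  induction k with
  | zero => simp [walkNum]
  | succ k ih =>
    have := Finset.sum_le_sum fun v (_ : v ∈ Finset.univ) => log_step G k v
    rw [Finset.sum_add_distrib, swap_sum] at this
    push_cast
    linarith

open Classical in
theorem log_deg {V : Type*} [Fintype V] (G : SimpleGraph V) (d : ℝ) (hd : 0 < d)
    (hs : ∑ v, (G.degree v : ℝ) = Fintype.card V * d) :
    (Fintype.card V * d) * Real.log d ≤ ∑ v, (G.degree v : ℝ) * Real.log (G.degree v) := by
  have : ∑ v, ((G.degree v : ℝ) * Real.log d) ≤
      ∑ v, ((G.degree v : ℝ) * Real.log (G.degree v) + d - G.degree v) := by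
    refine Finset.sum_le_sum fun v _ => ?_
    rcases Nat.eq_zero_or_pos (G.degree v) with h | h
    · simp [h, hd.le]
    · have h' : (0 : ℝ) < G.degree v := by exact_mod_cast h
      have := mul_le_mul_of_nonneg_left (log_tangent hd h') h'.le
      have e : (G.degree v : ℝ) * (d / G.degree v) = d := by field_simp
      linarith
  rw [← Finset.sum_mul, Finset.sum_sub_distrib, Finset.sum_add_distrib, hs] at this
  simp only [Finset.sum_const, Finset.card_univ, nsmul_eq_mul] at this
  linarith

open Classical in
theorem walk_lower {V : Type*} [Fintype V] (G : SimpleGraph V) (d : ℝ) (hd : 0 < d)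
    (hs : ∑ v, (G.degree v : ℝ) = Fintype.card V * d) (k : ℕ) :
    Fintype.card V * d ^ (k + 1) ≤ (walkSet G (k + 1)).card := by
  rw [walkSet_card]
  simp only [walkNum]
  rw [swap_sum]
  have hc : 0 < d ^ k := pow_pos hd k
  have h1 : ∑ v, (G.degree v : ℝ) * Real.log (walkNum G k v) ≤
      ∑ v, ((G.degree v : ℝ) * (k * Real.log d) +
        (G.degree v * walkNum G k v) / d ^ k - G.degree v) := by
    refine Finset.sum_le_sum fun v _ => ?_
    rcases Nat.eq_zero_or_pos (G.degree v) with h | h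
    · simp [h]
    · have h' : (0 : ℝ) < G.degree v := by exact_mod_cast h
      have := mul_le_mul_of_nonneg_left (log_tangent (walkNum_pos G k v h) hc) h'.le
      rw [Real.log_pow] at this
      rw [mul_div_assoc]
      linarith
  rw [Finset.sum_sub_distrib, Finset.sum_add_distrib, ← Finset.sum_div, ← Finset.sum_mul, hs] at h1
  have h2 := log_sum G k
  have h3 := mul_le_mul_of_nonneg_left (log_deg G d hd hs) (Nat.cast_nonneg (α := ℝ) k)
  have h4 : Fintype.card V * d ≤ (∑ v, G.degree v * walkNum G k v) / d ^ k := by linarith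
  rw [le_div_iff₀ hc] at h4
  rw [pow_succ]
  linarith

open Classical in
/-- Fibres of `tl` on walks have at most `Δ` elements. -/
theorem fibre_le {V : Type*} [Fintype V] (G : SimpleGraph V) (Δ : ℕ)
    (hΔ : ∀ v, G.degree v ≤ Δ) (k : ℕ) (g : Fin (k + 1) → V) :
    ((walkSet G (k + 1)).filter fun f => tl f = g).card ≤ Δ := by
  refine le_trans (Finset.card_le_card_of_injOn (t := G.neighborFinset (g 0)) (fun f => f 0) ?_ ?_)
    (hΔ (g 0))
  · intro f hf
    simp only [Finset.coe_filter, Set.mem_ofPred_eq, mem_walkSet_succ] at hf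
    obtain ⟨⟨h, _⟩, rfl⟩ := hf
    simpa using h.symm
  · intro f hf f' hf' h
    simp only [Finset.coe_filter, Set.mem_ofPred_eq] at hf hf'
    dsimp only at h
    rw [← cn_tl f, ← cn_tl f', hf.2, hf'.2, h]

open Classical in
theorem walkSet_le {V : Type*} [Fintype V] (G : SimpleGraph V) (Δ : ℕ)
    (hΔ : ∀ v, G.degree v ≤ Δ) (k : ℕ) :
    (walkSet G k).card ≤ Fintype.card V * Δ ^ k := by
  induction k with
  | zero =>
    refine (Finset.card_le_univ _).trans ?_
    simp
  | succ k ih =>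
    have := Finset.card_le_mul_card_image_of_maps_to (s := walkSet G (k + 1)) (t := walkSet G k)
      (f := tl) (fun f hf => ((mem_walkSet_succ G k f).1 hf).2) Δ
      (fun g _ => fibre_le G Δ hΔ k g)
    calc _ ≤ _ := this
      _ ≤ Δ * (Fintype.card V * Δ ^ k) := Nat.mul_le_mul_left _ ih
      _ = _ := by ring

open Classical in
theorem badSet_succ {V : Type*} [Fintype V] (G : SimpleGraph V) (Δ : ℕ)
    (hΔ : ∀ v, G.degree v ≤ Δ) (k : ℕ) :
    (badSet G (k + 1)).card ≤ Δ * (badSet G k).card + (k + 1) * (walkSet G k).card := by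
  set A := (walkSet G (k + 1)).filter fun f => tl f ∈ badSet G k
  set B := (walkSet G (k + 1)).filter fun f => ∃ i, tl f i = f 0
  have hsub : badSet G (k + 1) ⊆ A ∪ B := by
    intro f hf
    obtain ⟨hf, hi⟩ := Finset.mem_filter.1 hf
    have ht := ((mem_walkSet_succ G k f).1 hf).2
    by_cases hinj : Function.Injective (tl f)
    · refine Finset.mem_union_right _ (Finset.mem_filter.2 ⟨hf, ?_⟩)
      by_contra hno
      apply hi
      rw [← cn_tl f]
      refine Fin.cons_injective_iff.2 ?_
      exact ⟨fun ⟨i, h⟩ => hno ⟨i, h⟩, hinj⟩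
    · exact Finset.mem_union_left _ (Finset.mem_filter.2 ⟨hf, Finset.mem_filter.2 ⟨ht, hinj⟩⟩)
  have hA : A.card ≤ Δ * (badSet G k).card := by
    refine Finset.card_le_mul_card_image_of_maps_to (f := tl)
      (fun f hf => (Finset.mem_filter.1 hf).2) Δ fun g _ => ?_
    refine (Finset.card_le_card ?_).trans (fibre_le G Δ hΔ k g)
    exact Finset.filter_subset_filter _ (Finset.filter_subset _ _)
  have hB : B.card ≤ (k + 1) * (walkSet G k).card := by
    refine Finset.card_le_mul_card_image_of_maps_to (f := tl)
      (fun f hf => ((mem_walkSet_succ G k f).1 (Finset.mem_filter.1 hf).1).2) (k + 1)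
      fun g _ => ?_
    have : (B.filter fun f => tl f = g) ⊆
        Finset.univ.image fun i : Fin (k + 1) => cn (g i) g := by
      intro f hf
      obtain ⟨hfB, rfl⟩ := Finset.mem_filter.1 hf
      have hf2 : ∃ i, tl f i = f 0 := (Finset.mem_filter.1 hfB).2
      obtain ⟨i, hi⟩ := hf2
      refine Finset.mem_image.2 ⟨i, Finset.mem_univ _, ?_⟩
      rw [hi, cn_tl]
    refine (Finset.card_le_card this).trans (Finset.card_image_le.trans ?_)
    simp
  exact (Finset.card_le_card hsub).trans ((Finset.card_union_le _ _).trans (add_le_add hA hB))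

open Classical in
theorem badSet_le {V : Type*} [Fintype V] (G : SimpleGraph V) (Δ : ℕ)
    (hΔ : ∀ v, G.degree v ≤ Δ) (k : ℕ) :
    (badSet G (k + 1)).card ≤ Fintype.card V * ((k + 1) ^ 2 * Δ ^ k) := by
  induction k with
  | zero =>
    have h0 : badSet G 0 = ∅ :=
      Finset.filter_false_of_mem fun f _ => not_not.2 (fun a b _ =>
        (Fin.fin_one_eq_zero a).trans (Fin.fin_one_eq_zero b).symm)
    have := badSet_succ G Δ hΔ 0
    have h2 := walkSet_le G Δ hΔ 0
    rw [h0] at this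
    simp at this h2 ⊢
    omega
  | succ k ih =>
    have h1 := badSet_succ G Δ hΔ (k + 1)
    have h2 := walkSet_le G Δ hΔ (k + 1)
    calc _ ≤ _ := h1
      _ ≤ Δ * (Fintype.card V * ((k + 1) ^ 2 * Δ ^ k)) +
          (k + 1 + 1) * (Fintype.card V * Δ ^ (k + 1)) := by gcongr
      _ = Fintype.card V * (((k + 1) ^ 2 + (k + 1 + 1)) * Δ ^ (k + 1)) := by ring
      _ ≤ _ := by
        gcongr
        nlinarith

theorem pathCount_add {V : Type*} [Fintype V] (G : SimpleGraph V) (k : ℕ) :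
    pathCount G k + (badSet G k).card = (walkSet G k).card := by
  classical
  rw [← Finset.card_filter_add_card_filter_not (s := walkSet G k) (fun f => Function.Injective f)]
  congr 1
  · rw [pathCount, ← Set.ncard_coe_finset]
    congr 1
    ext f
    simp [mem_walkSet, and_comm]

/-- A graph with maximum degree at most `Δ` and average degree `d = 2e(G)/n` has
at least `n·(d^ℓ − ℓ²·Δ^{ℓ-1})` paths of length `ℓ`. -/
theorem path_count_lower_bound {V : Type*} [Fintype V] (G : SimpleGraph V)
    (Δ ℓ : ℕ) (hℓ : 1 ≤ ℓ) (hΔ : ∀ v : V, (G.neighborSet v).ncard ≤ Δ) :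
    (Fintype.card V : ℝ) *
      ((2 * (G.edgeSet.ncard : ℝ) / (Fintype.card V : ℝ)) ^ ℓ -
        (ℓ : ℝ) ^ 2 * (Δ : ℝ) ^ (ℓ - 1))
      ≤ (pathCount G ℓ : ℝ) := by
  classical
  obtain ⟨k, rfl⟩ : ∃ k, ℓ = k + 1 := ⟨ℓ - 1, by omega⟩
  have hdeg : ∀ v, G.degree v ≤ Δ := fun v => by
    have := hΔ v
    rwa [← coe_neighborFinset, Set.ncard_coe_finset, card_neighborFinset_eq_degree] at this
  have hb := badSet_le G Δ hdeg k
  have hp := pathCount_add G (k + 1)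
  have hb' : ((badSet G (k + 1)).card : ℝ) ≤
      Fintype.card V * (((k + 1 : ℕ) : ℝ) ^ 2 * (Δ : ℝ) ^ k) := by exact_mod_cast hb
  have hp' : (pathCount G (k + 1) : ℝ) + (badSet G (k + 1)).card = (walkSet G (k + 1)).card := by
    exact_mod_cast hp
  rw [Nat.add_sub_cancel]
  have he : ∑ v, (G.degree v : ℝ) = 2 * (G.edgeSet.ncard : ℝ) := by
    have := G.sum_degrees_eq_twice_card_edges
    rw [← coe_edgeFinset, Set.ncard_coe_finset]
    exact_mod_cast this
  set d : ℝ := 2 * (G.edgeSet.ncard : ℝ) / (Fintype.card V : ℝ) with hd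
  have hd0 : 0 ≤ d := by positivity
  have key : Fintype.card V * d ^ (k + 1) ≤ ((walkSet G (k + 1)).card : ℝ) := by
    rcases hd0.eq_or_lt with h | h
    · rw [← h]; simp
    · refine walk_lower G d h ?_ k
      have hn : (Fintype.card V : ℝ) ≠ 0 := by
        intro h0
        rw [hd, h0] at h
        simp at h
      rw [he, hd]
      field_simp
  rw [mul_sub]
  linarith
end

section
/- Let G be a graph, v a vertex of G, r ≥ 1 an integer, and s ≥ 5 an odd integer. Suppose N_r(v) is nonempty and the induced subgraph G[N_r(v)] has average degree at least 2s − 4, i.e. 2·e(G[N_r(v)]) ≥ (2s − 4)·|N_r(v)|. Then there exists an integer m with 1 ≤ m ≤ r such that G contains a cycle of length 2m + j for every odd j with 1 ≤ j ≤ s. -/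
open SimpleGraph

/-- `G` contains a cycle of length `m` (as a subgraph). -/
def HasCycleLength {V : Type*} (G : SimpleGraph V) (m : ℕ) : Prop :=
  ∃ (v : V) (w : G.Walk v v), w.IsCycle ∧ w.length = m

/-- `N_r(v)`: the set of vertices at distance exactly `r` from `v`. -/
def distSphere {V : Type*} (G : SimpleGraph V) (v : V) (r : ℕ) : Set V :=
  {u | G.Reachable v u ∧ G.dist v u = r}

theorem period_lemma {α : Type*} (f : ℤ → α) (n t l : ℤ) (hl1 : 1 ≤ l) (hln : l < n)
    (hodd : Odd l) (ht : 2 ≤ t) (htn : 2 * t ≤ n)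
    (hn : ∀ i, f (i + n) = f i) (h0 : ∀ i, f (i + l) = f i)
    (T1 : l ≤ n - t → ∀ i, 0 ≤ i → i ≤ l - 1 → f (-i) = f (t + (l - 1 - i)))
    (T2 : ∀ i, 0 ≤ i → i < n - t → 0 ≤ l - 1 - i → l - 1 - i < t →
      f (-i) = f (t - (l - 1 - i)))
    (T3 : ∀ i, 0 ≤ i → i < t → 0 ≤ l - 1 - i → l - 1 - i < n - t →
      f i = f (t + (l - 1 - i))) :
    ∀ i, f i = f 0 := by
  let H : AddSubgroup ℤ :=
    { carrier := {p | ∀ i, f (i + p) = f i}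
      zero_mem' := by intro i; simp
      add_mem' := by
        intro a b ha hb i
        rw [← add_assoc, hb, ha]
      neg_mem' := by
        intro a ha i
        have := ha (i + -a)
        rw [← this]; congr 1; ring }
  have hH : ∀ p, p ∈ H ↔ ∀ i, f (i + p) = f i := fun p => Iff.rfl
  obtain ⟨d, hd⟩ : ∃ d : ℕ, ∀ p, p ∈ H ↔ (d : ℤ) ∣ p := by
    obtain ⟨a, ha⟩ := Int.subgroup_cyclic H
    refine ⟨a.natAbs, fun p => ?_⟩
    rw [ha, Int.natAbs_dvd, ← AddSubgroup.zmultiples_eq_closure, Int.mem_zmultiples_iff]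
  have hdn : (d : ℤ) ∣ n := (hd n).1 hn
  have hdl : (d : ℤ) ∣ l := (hd l).1 h0
  have hdpos : (0 : ℤ) < d := by
    rcases Nat.eq_zero_or_pos d with h | h
    · subst h
      simp at hdl
      omega
    · exact_mod_cast h
  have hdlel : (d : ℤ) ≤ l := Int.le_of_dvd (by omega) hdl
  have hper : ∀ q i, f (i + d * q) = f i := fun q => (hH _).1 ((hd _).2 (dvd_mul_right _ _))
  have hper' : ∀ q i, f (i - d * q) = f i := fun q i => by
    have := hper (-q) i
    rw [← this]; congr 1; ring
  have hrep : ∀ a x : ℤ, ∃ q, a ≤ x + d * q ∧ x + d * q < a + d := by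
    intro a x
    refine ⟨-((x - a) / d), ?_⟩
    have h1 := Int.emod_add_mul_ediv (x - a) d
    have h2 := Int.emod_nonneg (x - a) hdpos.ne'
    have h3 := Int.emod_lt_of_pos (x - a) hdpos
    have h4 : (d:ℤ) * -((x - a) / d) = - (d * ((x-a)/d)) := by ring
    rw [h4]
    constructor <;> omega
  obtain ⟨a, b, ha1, ha2, ha3, hb1, hb2, hb3⟩ : ∃ a b : ℤ,
      0 ≤ a ∧ (l - t ≤ a) ∧ (a + d ≤ l ∧ a + d ≤ n - t) ∧
      0 ≤ b ∧ (l - (n - t) ≤ b) ∧ (b + d ≤ l ∧ b + d ≤ t) := by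
    by_cases hc : l ≤ n - t
    · have hdt : (d : ℤ) ∣ t - 1 := by
        rw [← hd, hH]
        intro x
        obtain ⟨q, hq1, hq2⟩ := hrep 0 (-x)
        have := T1 hc _ hq1 (by omega)
        have e1 : -(-x + d * q) = x - d * q := by ring
        have e2 : t + (l - 1 - (-x + d * q)) = ((x + (t - 1)) - d * q) + l := by ring
        rw [e1, e2, h0, hper', hper'] at this
        exact this.symm
      have hdt' : (d : ℤ) ≤ t - 1 := Int.le_of_dvd (by omega) hdt
      refine ⟨max 0 (l - t), 0, ?_⟩
      omega
    · have : (d : ℤ) ≤ n - l := Int.le_of_dvd (by omega) (dvd_sub hdn hdl)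
      refine ⟨max 0 (l - t), max 0 (l - (n - t)), ?_⟩
      omega
  have R1 : ∀ x, f x = f (t + 1 - x) := by
    intro x
    obtain ⟨q, hq1, hq2⟩ := hrep a (-x)
    have := T2 (-x + d * q) (by omega) (by omega) (by omega) (by omega)
    have e1 : -(-x + d * q) = x - d * q := by ring
    have e2 : t + 1 - x = (t - (l - 1 - (-x + d * q))) + l - d * q := by ring
    rw [e2, hper', h0, ← this, e1, hper']
  have R2 : ∀ x, f x = f (t - 1 - x) := by
    intro x
    obtain ⟨q, hq1, hq2⟩ := hrep b x
    have := T3 (x + d * q) (by omega) (by omega) (by omega) (by omega)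
    have e2 : t + (l - 1 - (x + d * q)) = (t - 1 - x) - d * q + l := by ring
    rw [hper, e2, h0, hper'] at this
    exact this
  have h2 : (d : ℤ) ∣ 2 := by
    rw [← hd, hH]
    intro x
    rw [R1 (x + 2), R2 x]; congr 1; ring
  have h1 : (d : ℤ) ∣ 1 := by
    obtain ⟨k, hk⟩ := hodd
    have : (1 : ℤ) = l - 2 * k := by omega
    rw [this]
    exact dvd_sub hdl (h2.mul_right _)
  intro i
  have := (hH _).1 ((hd i).2 (h1.trans (one_dvd i))) 0
  simpa using this

/-- a path of length `l` inside `S`, given as a function -/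
def PathFun {V : Type*} (G : SimpleGraph V) (S : Set V) (g : ℕ → V) (l : ℕ) : Prop :=
  (∀ i ≤ l, g i ∈ S) ∧ (∀ i < l, G.Adj (g i) (g (i + 1))) ∧
    ∀ i ≤ l, ∀ j ≤ l, g i = g j → i = j

theorem walk_of_fun {V : Type*} (G : SimpleGraph V) (f : ℕ → V) (l : ℕ)
    (hadj : ∀ i < l, G.Adj (f i) (f (i + 1))) :
    ∃ w : G.Walk (f 0) (f l), w.length = l ∧ w.support = (List.range (l + 1)).map f := by
  induction l with
  | zero => exact ⟨Walk.nil, rfl, rfl⟩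
  | succ l ih =>
    obtain ⟨w, hw, hs⟩ := ih (fun i hi => hadj i (by omega))
    refine ⟨w.concat (hadj l (by omega)), by simp [hw], ?_⟩
    rw [Walk.support_concat, hs, List.range_succ (n := l + 1)]
    simp

theorem cycle_of_fun {V : Type*} (G : SimpleGraph V) (f : ℕ → V) (l : ℕ) (hl : 2 ≤ l)
    (hadj : ∀ i < l, G.Adj (f i) (f (i + 1)))
    (hinj : ∀ i ≤ l, ∀ j ≤ l, f i = f j → i = j)
    (hlast : G.Adj (f l) (f 0)) : HasCycleLength G (l + 1) := by
  obtain ⟨w, hw, hs⟩ := walk_of_fun G f l hadj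
  have hp : w.IsPath := by
    rw [Walk.isPath_def, hs]
    refine List.Nodup.map_on ?_ List.nodup_range
    intro x hx y hy
    simp only [List.mem_range] at hx hy
    exact hinj x (by omega) y (by omega)
  refine ⟨_, Walk.cons hlast w, ?_, by simp [hw]⟩
  rw [Walk.isCycle_iff_isPath_tail_and_le_length]
  exact ⟨by simpa using hp, by simp [hw]; omega⟩

theorem glue {V : Type*} (G : SimpleGraph V) (v : V) (r m j : ℕ) (hm1 : 1 ≤ m) (hmr : m ≤ r)
    (hj : 1 ≤ j) (par : V → V)
    (hd : ∀ x, ∀ k, x ∈ distSphere G v r → k ≤ r → G.dist v (par^[k] x) = r - k)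
    (ha : ∀ x, ∀ k, x ∈ distSphere G v r → k < r → G.Adj (par^[k] x) (par^[k+1] x))
    (g : ℕ → V) (hg : PathFun G (distSphere G v r) g j)
    (heq : par^[m] (g 0) = par^[m] (g j)) (hne : par^[m-1] (g 0) ≠ par^[m-1] (g j)) :
    HasCycleLength G (2 * m + j) := by
  obtain ⟨hS, hadj, hinj⟩ := hg
  have hne' : ∀ k < m, par^[k] (g 0) ≠ par^[k] (g j) := by
    intro k hk h
    apply hne
    have : m - 1 = (m - 1 - k) + k := by omega
    rw [this, Function.iterate_add_apply, Function.iterate_add_apply, h]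
  let F : ℕ → V := fun i => if i ≤ j then g i else
    if i ≤ j + m then par^[i - j] (g j) else par^[2 * m + j - i] (g 0)
  have F1 : ∀ i, i ≤ j → F i = g i := fun i hi => by simp [F, hi]
  have F2 : ∀ i, j ≤ i → i ≤ j + m → F i = par^[i - j] (g j) := fun i h1 h2 => by
    by_cases h : i = j
    · subst h; simp [F]
    · simp [F, h2, show ¬ i ≤ j by omega]
  have F3 : ∀ i, j + m ≤ i → F i = par^[2 * m + j - i] (g 0) := fun i h1 => by
    by_cases h : i = j + m
    · subst h; rw [F2 _ (by omega) le_rfl, show 2 * m + j - (j + m) = m by omega, heq]; simp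
    · simp [F, show ¬ i ≤ j by omega, show ¬ i ≤ j + m by omega]
  have S0 := hS 0 (by omega)
  have Sj := hS j le_rfl
  have D1 : ∀ i, i ≤ j → G.dist v (F i) = r := fun i hi => by
    rw [F1 i hi]; exact (hS i hi).2
  have D2 : ∀ i, j ≤ i → i ≤ j + m → G.dist v (F i) = r - (i - j) := fun i h1 h2 => by
    rw [F2 i h1 h2]; exact hd _ _ Sj (by omega)
  have D3 : ∀ i, j + m ≤ i → G.dist v (F i) = r - (2 * m + j - i) := fun i h1 => by
    rw [F3 i h1]; exact hd _ _ S0 (by omega)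
  have key : ∀ a b, a < b → b ≤ 2 * m + j - 1 → F a ≠ F b := by
    intro a b hab hb h
    have hD := congrArg (G.dist v) h
    rcases le_or_gt b j with hbj | hbj
    · rw [F1 a (by omega), F1 b hbj] at h
      have := hinj a (by omega) b hbj h
      omega
    rcases le_or_gt a j with haj | haj
    · rw [D1 a haj] at hD
      rcases le_or_gt b (j + m) with hbm | hbm
      · rw [D2 b (by omega) hbm] at hD; omega
      · rw [D3 b (by omega)] at hD; omega
    rcases le_or_gt b (j + m) with hbm | hbm
    · rw [D2 b (by omega) hbm, D2 a (by omega) (by omega)] at hD; omega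
    rcases le_or_gt a (j + m) with ham | ham
    · rw [D2 a (by omega) ham, D3 b (by omega)] at hD
      rw [F2 a (by omega) ham, F3 b (by omega), show 2 * m + j - b = a - j by omega] at h
      exact hne' (a - j) (by omega) h.symm
    · rw [D3 a (by omega), D3 b (by omega)] at hD; omega
  rw [show 2 * m + j = (2 * m + j - 1) + 1 by omega]
  apply cycle_of_fun G F _ (by omega)
  · intro i hi
    rcases lt_or_ge i j with h | h
    · rw [F1 i (by omega), F1 (i+1) (by omega)]; exact hadj i h
    rcases lt_or_ge i (j + m) with h' | h'
    · rw [F2 i (by omega) (by omega), F2 (i+1) (by omega) (by omega),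
        show i + 1 - j = i - j + 1 by omega]
      exact ha _ _ Sj (by omega)
    · rw [F3 i h', F3 (i + 1) (by omega),
        show 2 * m + j - i = 2 * m + j - (i + 1) + 1 by omega]
      exact (ha _ _ S0 (by omega)).symm
  · intro a h1 b h2 h
    rcases lt_trichotomy a b with h' | h' | h'
    · exact absurd h (key a b h' h2)
    · exact h'
    · exact absurd h.symm (key b a h' h1)
  · rw [F1 0 (by omega), F3 _ (by omega), show 2 * m + j - (2 * m + j - 1) = 0 + 1 by omega]
    exact (ha _ 0 S0 (by omega)).symm

theorem exists_par {V : Type*} (G : SimpleGraph V) (v : V) : ∃ par : V → V, ∀ r,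
    (∀ x, ∀ k, x ∈ distSphere G v r → k ≤ r → par^[k] x ∈ distSphere G v (r - k)) ∧
    (∀ x, ∀ k, x ∈ distSphere G v r → k < r → G.Adj (par^[k] x) (par^[k+1] x)) := by
  have h1 : ∀ x, ∃ y, ∀ r, x ∈ distSphere G v (r + 1) → y ∈ distSphere G v r ∧ G.Adj x y := by
    intro x
    by_cases hx : ∃ r, x ∈ distSphere G v (r + 1)
    · obtain ⟨r, hr, hd⟩ := hx
      obtain ⟨w, hw⟩ := hr.exists_walk_length_eq_dist
      have hnn : ¬ w.Nil := by
        intro h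
        have := Walk.length_eq_zero_iff.2 h
        omega
      have hadj := w.adj_penultimate hnn
      refine ⟨w.penultimate, fun r' hr' => ⟨⟨w.dropLast.reachable, ?_⟩, hadj.symm⟩⟩
      have e : r' = r := by have := hr'.2; omega
      subst e
      have l1 : w.dropLast.length + 1 = w.length := by
        simp; omega
      have l2 := dist_le w.dropLast
      have l3 : G.dist v x ≤ G.dist v w.penultimate + 1 := by
        obtain ⟨w', hw'⟩ := w.dropLast.reachable.exists_walk_length_eq_dist
        have := dist_le (w'.concat hadj)
        simpa [hw'] using this
      omega
    · exact ⟨x, fun r hr => absurd ⟨r, hr⟩ hx⟩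
  choose par hpar using h1
  refine ⟨par, fun r => ?_⟩
  have hA : ∀ x, ∀ k, x ∈ distSphere G v r → k ≤ r → par^[k] x ∈ distSphere G v (r - k) := by
    intro x k hx hk
    induction k with
    | zero => simpa using hx
    | succ k ih =>
      rw [Function.iterate_succ_apply']
      apply (hpar _ _ _).1
      rw [show r - (k + 1) + 1 = r - k by omega]
      exact ih (by omega)
  refine ⟨hA, fun x k hx hk => ?_⟩
  rw [Function.iterate_succ_apply']
  apply (hpar _ (r - (k + 1)) _).2
  rw [show r - (k + 1) + 1 = r - k by omega]
  exact hA x k hx (by omega)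

/-- cycle of length `n` inside `S` with a chord from `c 0` to `c t` -/
structure IsTheta {V : Type*} (G : SimpleGraph V) (S : Set V) (c : ℤ → V) (n t : ℤ) : Prop where
  mem : ∀ i, c i ∈ S
  inj : ∀ i j, c i = c j ↔ n ∣ i - j
  adj : ∀ i, G.Adj (c i) (c (i + 1))
  chord : G.Adj (c 0) (c t)
  two_le : 2 ≤ t
  le_n : 2 * t ≤ n

theorem IsTheta.path {V : Type*} {G : SimpleGraph V} {S : Set V} {c : ℤ → V} {n t : ℤ}
    (h : IsTheta G S c n t) (u : ℕ → ℤ) (l : ℕ) (a : ℤ)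
    (hu : ∀ i ≤ l, a ≤ u i ∧ u i < a + n)
    (hinj : ∀ i ≤ l, ∀ j ≤ l, u i = u j → i = j)
    (hadj : ∀ i < l, u (i + 1) = u i + 1 ∨ u i = u (i + 1) + 1 ∨ (u i = 0 ∧ u (i + 1) = t)) :
    PathFun G S (fun i => c (u i)) l := by
  refine ⟨fun i _ => h.mem _, fun i hi => ?_, fun i hi j hj hij => ?_⟩
  · rcases hadj i hi with e | e | ⟨e1, e2⟩
    · simp only [e]; exact h.adj _
    · simp only [e]; exact (h.adj _).symm
    · simp only [e1, e2]; exact h.chord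
  · apply hinj i hi j hj
    have hdvd := (h.inj _ _).1 hij
    have h1 := hu i hi
    have h2 := hu j hj
    have := Int.eq_zero_of_abs_lt_dvd hdvd (by rw [abs_lt]; constructor <;> omega)
    omega

theorem IsTheta.const {V α : Type*} {G : SimpleGraph V} {S : Set V} {c : ℤ → V} {n t : ℤ}
    (h : IsTheta G S c n t) (l : ℕ) (hl1 : 1 ≤ l) (hln : (l : ℤ) < n) (hodd : Odd l)
    (F : V → α) (hF : ∀ g : ℕ → V, PathFun G S g l → F (g 0) = F (g l)) :
    ∀ i, F (c i) = F (c 0) := by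
  have ht := h.two_le
  have htn := h.le_n
  refine period_lemma (fun i => F (c i)) n t l (by omega) hln (by exact_mod_cast hodd) ht htn
    ?_ ?_ ?_ ?_ ?_
  · intro i
    have : c (i + n) = c i := (h.inj _ _).2 (by simp)
    simp only [this]
  · intro i
    have := hF _ (h.path (fun k => i + k) l i (by intros; omega) (by intros; omega)
      (by intros; push_cast; omega))
    simpa using this.symm
  · intro hc i h1 h2
    have := hF _ (h.path (fun k => if (k : ℤ) ≤ i then -i + k else t + (k - i - 1)) l (-i)
      (by intro k hk; split_ifs <;> omega)
      (by intro k hk k' hk' he; split_ifs at he <;> omega)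
      (by intro k hk; push_cast; split_ifs <;> omega))
    simp only [Nat.cast_zero, h1, if_true, show ¬ (l : ℤ) ≤ i by omega, if_false, add_zero,
      sub_zero] at this
    rw [this]; congr 2; ring
  · intro i h1 h2 h3 h4
    have := hF _ (h.path (fun k => if (k : ℤ) ≤ i then -i + k else t - (k - i - 1)) l (-i)
      (by intro k hk; split_ifs <;> omega)
      (by intro k hk k' hk' he; split_ifs at he <;> omega)
      (by intro k hk; push_cast; split_ifs <;> omega))
    simp only [Nat.cast_zero, h1, if_true, show ¬ (l : ℤ) ≤ i by omega, if_false, add_zero,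
      sub_zero] at this
    rw [this]; congr 2; ring
  · intro i h1 h2 h3 h4
    have := hF _ (h.path (fun k => if (k : ℤ) ≤ i then i - k else t + (k - i - 1)) l 0
      (by intro k hk; split_ifs <;> omega)
      (by intro k hk k' hk' he; split_ifs at he <;> omega)
      (by intro k hk; push_cast; split_ifs <;> omega))
    simp only [Nat.cast_zero, h1, if_true, show ¬ (l : ℤ) ≤ i by omega, if_false, add_zero,
      sub_zero] at this
    rw [this]; congr 2; ring

theorem theta_of_path {V : Type*} {G : SimpleGraph V} {S : Set V} (p : ℕ → V) (k j : ℕ)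
    (hp : PathFun G S p k) (hk : G.Adj (p 0) (p k)) (hj2 : 2 ≤ j) (hjk : j < k)
    (hj : G.Adj (p 0) (p j)) : ∃ c t, IsTheta G S c ((k + 1 : ℕ) : ℤ) t := by
  obtain ⟨hS, hadj, hinj⟩ := hp
  have hn : (0 : ℤ) < ((k + 1 : ℕ) : ℤ) := by positivity
  set n : ℤ := ((k + 1 : ℕ) : ℤ) with hndef
  let c : ℤ → V := fun i => p (i % n).toNat
  have hb : ∀ i : ℤ, (i % n).toNat ≤ k := fun i => by
    have := Int.emod_lt_of_pos i hn; omega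
  have cinj : ∀ a b, c a = c b ↔ n ∣ a - b := by
    intro a b
    have ha0 := Int.emod_nonneg a hn.ne'
    have hb0 := Int.emod_nonneg b hn.ne'
    rw [Int.dvd_iff_emod_eq_zero, ← Int.emod_eq_emod_iff_emod_sub_eq_zero]
    constructor
    · intro h
      have := hinj _ (hb a) _ (hb b) h
      omega
    · intro h
      simp only [c, h]
  have cadj : ∀ i, G.Adj (c i) (c (i + 1)) := by
    intro i
    have h0 := Int.emod_nonneg i hn.ne'
    have h1 := Int.emod_lt_of_pos i hn
    have h2 : (i + 1) % n = (i % n + 1) % n := by simp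
    simp only [c]
    rw [h2]
    by_cases h : i % n = k
    · have e : (i % n + 1) % n = 0 := by
        rw [h]; simp [hndef]
      rw [e, h]; simpa using hk.symm
    · rw [Int.emod_eq_of_lt (by omega) (by omega : i % n + 1 < n),
        show (i % n + 1).toNat = (i % n).toNat + 1 by omega]
      exact hadj _ (by omega)
  have c0 : c 0 = p 0 := by simp [c]
  have cj : c j = p j := by
    simp only [c]; rw [Int.emod_eq_of_lt (by omega) (by omega)]; simp
  by_cases h : 2 * (j : ℤ) ≤ n
  · exact ⟨c, j, fun i => hS _ (hb i), cinj, cadj, by rw [c0, cj]; exact hj, by omega, h⟩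
  · refine ⟨fun i => c (-i), n - j, fun i => hS _ (hb _), ?_, ?_, ?_, by omega, by omega⟩
    · intro a b
      rw [cinj, ← dvd_neg]; congr! 1; ring
    · intro i
      have := (cadj (-(i + 1))).symm
      simpa using this
    · have : c (-(n - j)) = c j := by rw [cinj]; exact ⟨-1, by ring⟩
      simp only [neg_zero]
      rw [this, c0, cj]; exact hj

open Classical in
/-- ordered adjacent pairs inside `W` -/
noncomputable def prs {V : Type*} (G : SimpleGraph V) (W : Finset V) : Finset (V × V) :=
  (W ×ˢ W).filter (fun q => G.Adj q.1 q.2)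

theorem mem_prs {V : Type*} {G : SimpleGraph V} {W : Finset V} {q : V × V} :
    q ∈ prs G W ↔ (q.1 ∈ W ∧ q.2 ∈ W) ∧ G.Adj q.1 q.2 := by
  simp [prs]

open Classical in
theorem theta_of_dense {V : Type*} (G : SimpleGraph V) (W₀ : Finset V) (s : ℕ) (hs : 5 ≤ s)
    (hne : W₀.Nonempty) (hd : 2 * (s - 2) * W₀.card ≤ (prs G W₀).card) :
    ∃ (n : ℕ) (c : ℤ → V) (t : ℤ), s < n ∧ IsTheta G (W₀ : Set V) c n t := by
  obtain ⟨W, hWsub, hmin⟩ := exists_minimal_le_of_wellFoundedLT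
    (fun W : Finset V => W.Nonempty ∧ 2 * (s - 2) * W.card ≤ (prs G W).card) W₀ ⟨hne, hd⟩
  obtain ⟨⟨hWne, hWd⟩, hWmin⟩ := hmin
  have hrem : ∀ X : Finset V, X ⊆ W → X.Nonempty → X ≠ W → ∀ P : Finset (V × V),
      (∀ x y, x ∈ W → y ∈ W → G.Adj x y → (x ∈ X ∨ y ∈ X) → (x, y) ∈ P) →
      2 * (s - 2) * X.card < P.card := by
    intro X hX hXne hXW P hP
    by_contra hcon
    push Not at hcon
    have hne' : (W \ X).Nonempty := by
      rw [Finset.sdiff_nonempty]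
      exact fun h => hXW (hX.antisymm h)
    have hsub : prs G W ⊆ prs G (W \ X) ∪ P := by
      rintro ⟨x, y⟩ hq
      rw [mem_prs] at hq
      by_cases hxy : x ∈ X ∨ y ∈ X
      · exact Finset.mem_union_right _ (hP x y hq.1.1 hq.1.2 hq.2 hxy)
      · apply Finset.mem_union_left
        rw [mem_prs]
        simp only [Finset.mem_sdiff]
        tauto
    have h1 := (Finset.card_le_card hsub).trans (Finset.card_union_le _ _)
    have h2 : (W \ X).card + X.card = W.card := Finset.card_sdiff_add_card_eq_card hX
    rw [← h2, mul_add] at hWd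
    have h3 := hWmin (y := W \ X) ⟨hne', by omega⟩ Finset.sdiff_subset
    obtain ⟨x, hx⟩ := hXne
    have := h3 (hX hx)
    simp [hx] at this
  -- minimum degree
  have hdeg : ∀ x ∈ W, s - 1 ≤ (W.filter (fun y => G.Adj x y)).card := by
    intro x hx
    have hxW : ({x} : Finset V) ≠ W := by
      rintro rfl
      have : prs G {x} = ∅ := by
        ext ⟨a, b⟩
        rw [mem_prs]
        simp only [Finset.mem_singleton, Finset.notMem_empty, iff_false]
        rintro ⟨⟨rfl, rfl⟩, h⟩
        exact h.ne rfl
      rw [this] at hWd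
      simp at hWd
      omega
    have := hrem {x} (by simpa using hx) (by simp) hxW
      ((W.filter (fun y => G.Adj x y)).image (fun y => (x, y)) ∪
        (W.filter (fun y => G.Adj x y)).image (fun y => (y, x))) (by
        intro a b ha hb hab h
        simp only [Finset.mem_singleton] at h
        rcases h with rfl | rfl
        · simp [hb, hab]
        · simp [ha, hab.symm])
    have h2 := Finset.card_union_le ((W.filter (fun y => G.Adj x y)).image (fun y => (x, y)))
        ((W.filter (fun y => G.Adj x y)).image (fun y => (y, x)))
    have h3 := Finset.card_image_le (s := W.filter (fun y => G.Adj x y)) (f := fun y => (x, y))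
    have h4 := Finset.card_image_le (s := W.filter (fun y => G.Adj x y)) (f := fun y => (y, x))
    simp only [Finset.card_singleton] at this
    omega
  -- longest path
  have hbd : ∀ p L, PathFun G (W : Set V) p L → L < W.card := by
    intro p L hp
    have : ((Finset.range (L + 1)).image p).card = L + 1 := by
      rw [Finset.card_image_of_injOn, Finset.card_range]
      intro a ha b hb
      simp only [Finset.coe_range, Set.mem_Iio] at ha hb
      exact hp.2.2 a (by omega) b (by omega)
    have h2 : (Finset.range (L + 1)).image p ⊆ W := by
      intro y hy
      simp only [Finset.mem_image, Finset.mem_range] at hy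
      obtain ⟨a, ha, rfl⟩ := hy
      exact hp.1 a (by omega)
    have := Finset.card_le_card h2
    omega
  obtain ⟨w, hw⟩ := hWne
  obtain ⟨L, ⟨p, hp⟩, hLmax⟩ : ∃ L, (∃ p, PathFun G (W : Set V) p L) ∧
      ∀ L' p, PathFun G (W : Set V) p L' → L' ≤ L := by
    have hex : ∃ p, PathFun G (W : Set V) p 0 :=
      ⟨fun _ => w, fun _ _ => hw, fun i hi => by omega, fun i hi j hj _ => by omega⟩
    let Q : ℕ → Prop := fun L => ∃ p, PathFun G (W : Set V) p L
    refine ⟨Nat.findGreatest Q W.card, Nat.findGreatest_spec (P := Q) (Nat.zero_le _) hex, ?_⟩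
    intro L' p hp
    exact Nat.le_findGreatest (P := Q) (hbd p L' hp).le ⟨p, hp⟩
  have hnb : ∀ p, PathFun G (W : Set V) p L → ∀ y ∈ W, G.Adj (p 0) y →
      ∃ i, 1 ≤ i ∧ i ≤ L ∧ y = p i := by
    intro p hp y hy hadj
    by_contra hcon
    push Not at hcon
    have hny : ∀ i ≤ L, y ≠ p i := by
      intro i hi h
      rcases Nat.eq_zero_or_pos i with h0 | h0
      · subst h0; exact hadj.ne h.symm
      · exact hcon i h0 hi h
    have := hLmax (L + 1) (fun i => if i = 0 then y else p (i - 1)) ⟨?_, ?_, ?_⟩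
    · omega
    · intro i hi
      dsimp only
      split_ifs with h
      · exact hy
      · exact hp.1 _ (by omega)
    · intro i hi
      rcases Nat.eq_zero_or_pos i with h0 | h0
      · subst h0; simpa using hadj.symm
      · have := hp.2.1 (i - 1) (by omega)
        rw [show i - 1 + 1 = i by omega] at this
        simpa [h0.ne'] using this
    · intro i hi j hj
      dsimp only
      split_ifs with h1 h2 h2
      · intro _; omega
      · intro h; exact absurd h (hny _ (by omega))
      · intro h; exact absurd h.symm (hny _ (by omega))
      · intro h
        have := hp.2.2 _ (by omega) _ (by omega) h
        omega
  by_contra hcon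
  have hshort : ∀ p, PathFun G (W : Set V) p L → ∀ y ∈ W, G.Adj (p 0) y →
      ∃ i, 1 ≤ i ∧ i ≤ s - 1 ∧ i ≤ L ∧ y = p i := by
    intro p hp
    by_contra hno
    push Not at hno
    obtain ⟨y, hy, hay, hno⟩ := hno
    obtain ⟨i₀, hi1, hiL, rfl⟩ := hnb p hp y hy hay
    have hi0 : s ≤ i₀ := by
      by_contra h
      exact hno i₀ hi1 (by omega) hiL rfl
    let Q : ℕ → Prop := fun i => G.Adj (p 0) (p i)
    obtain ⟨k, hk, hkL, hik, hkmax⟩ : ∃ k, G.Adj (p 0) (p k) ∧ k ≤ L ∧ i₀ ≤ k ∧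
        ∀ i ≤ L, G.Adj (p 0) (p i) → i ≤ k :=
      ⟨Nat.findGreatest Q L, Nat.findGreatest_spec (P := Q) hiL hay, Nat.findGreatest_le _,
        Nat.le_findGreatest (P := Q) hiL hay, fun i hi h => Nat.le_findGreatest (P := Q) hi h⟩
    obtain ⟨j, hj2, hjk, hj⟩ : ∃ j, 2 ≤ j ∧ j < k ∧ G.Adj (p 0) (p j) := by
      by_contra hnj
      push Not at hnj
      have hsub : W.filter (fun y => G.Adj (p 0) y) ⊆ {p 1, p k} := by
        intro y hy
        rw [Finset.mem_filter] at hy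
        obtain ⟨i, h1, h2, rfl⟩ := hnb p hp y hy.1 hy.2
        have h3 := hkmax i h2 hy.2
        have h4 : i = 1 ∨ i = k := by
          by_contra h
          exact hnj i (by omega) (by omega) hy.2
        rcases h4 with rfl | rfl <;> simp
      have h1 := Finset.card_le_card hsub
      have h2 := Finset.card_le_two (a := p 1) (b := p k)
      have h3 := hdeg (p 0) (hp.1 0 (by omega))
      omega
    obtain ⟨c, t, hct⟩ := theta_of_path (S := (W : Set V)) p k j
      ⟨fun i hi => hp.1 i (by omega), fun i hi => hp.2.1 i (by omega),
        fun i hi j hj => hp.2.2 i (by omega) j (by omega)⟩ hk hj2 hjk hj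
    exact hcon ⟨k + 1, c, t, by omega,
      ⟨fun i => hWsub (hct.mem i), hct.inj, hct.adj, hct.chord, hct.two_le, hct.le_n⟩⟩
  -- all of the first vertices are neighbours of `p 0`
  have hfull : s - 1 ≤ L ∧ ∀ i, 1 ≤ i → i ≤ s - 1 → G.Adj (p 0) (p i) := by
    have hsub : W.filter (fun y => G.Adj (p 0) y) ⊆
        ((Finset.Icc 1 (min (s - 1) L)).filter (fun i => G.Adj (p 0) (p i))).image p := by
      intro y hy
      rw [Finset.mem_filter] at hy
      obtain ⟨i, h1, h2, h3, rfl⟩ := hshort p hp y hy.1 hy.2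
      apply Finset.mem_image_of_mem
      simp [h1, h2, h3, hy.2]
    have h1 := (Finset.card_le_card hsub).trans Finset.card_image_le
    have h3 := hdeg (p 0) (hp.1 0 (by omega))
    have h4 := Finset.card_filter_le (Finset.Icc 1 (min (s - 1) L)) (fun i => G.Adj (p 0) (p i))
    rw [Nat.card_Icc] at h4
    refine ⟨by omega, ?_⟩
    have h5 := Finset.eq_of_subset_of_card_le
      (Finset.filter_subset (fun i => G.Adj (p 0) (p i)) (Finset.Icc 1 (min (s - 1) L)))
      (by rw [Nat.card_Icc]; omega)
    intro i hi1 hi2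
    have : i ∈ Finset.Icc 1 (min (s - 1) L) := by rw [Finset.mem_Icc]; omega
    rw [← h5] at this
    exact (Finset.mem_filter.1 this).2
  obtain ⟨hsL, hfull⟩ := hfull
  have hclosed : ∀ i < s - 1, ∀ y ∈ W, G.Adj (p i) y → ∃ j ≤ s - 1, y = p j := by
    intro i hi y hy hay
    have hrot : PathFun G (W : Set V) (fun k => if k ≤ i then p (i - k) else p k) L := by
      refine ⟨?_, ?_, ?_⟩
      · intro k hk
        dsimp only
        split_ifs
        · exact hp.1 _ (by omega)
        · exact hp.1 _ hk
      · intro k hk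
        dsimp only
        split_ifs with h1 h2 h2
        · have := hp.2.1 (i - (k + 1)) (by omega)
          rw [show i - (k + 1) + 1 = i - k by omega] at this
          exact this.symm
        · have : k = i := by omega
          subst this
          simpa using hfull (k + 1) (by omega) (by omega)
        · omega
        · exact hp.2.1 k hk
      · intro a ha b hb h
        dsimp only at h
        split_ifs at h <;>
        · have := hp.2.2 _ (by omega) _ (by omega) h
          omega
    obtain ⟨j, h1, h2, h3, h4⟩ := hshort _ hrot y hy (by simpa using hay)
    split_ifs at h4
    · exact ⟨i - j, by omega, h4⟩
    · exact ⟨j, h2, h4⟩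
  have hpinj : ∀ N, N ≤ s → ((Finset.range N).image p).card = N := by
    intro N hN
    rw [Finset.card_image_of_injOn, Finset.card_range]
    intro a ha b hb
    simp only [Finset.coe_range, Set.mem_Iio] at ha hb
    exact hp.2.2 a (by omega) b (by omega)
  have hfin := hrem ((Finset.range (s - 1)).image p) ?_ ?_ ?_ ((Finset.range s).image p).offDiag ?_
  · rw [Finset.offDiag_card, hpinj _ (by omega), hpinj _ le_rfl] at hfin
    obtain ⟨q, rfl⟩ : ∃ q, s = q + 5 := ⟨s - 5, by omega⟩
    simp only [show q + 5 - 1 = q + 4 by omega, show q + 5 - 2 = q + 3 by omega] at hfin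
    have : (q + 5) * (q + 5) - (q + 5) = (q + 4) * (q + 5) := by
      rw [show (q + 5) * (q + 5) = (q + 4) * (q + 5) + (q + 5) by ring]; simp
    rw [this] at hfin
    nlinarith
  · intro y hy
    simp only [Finset.mem_image, Finset.mem_range] at hy
    obtain ⟨a, ha, rfl⟩ := hy
    exact hp.1 a (by omega)
  · exact ⟨p 0, Finset.mem_image_of_mem _ (by simp; omega)⟩
  · intro h
    have : p (s - 1) ∈ W := hp.1 _ hsL
    rw [← h] at this
    simp only [Finset.mem_image, Finset.mem_range] at this
    obtain ⟨a, ha, hae⟩ := this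
    have := hp.2.2 a (by omega) _ hsL hae
    omega
  · have key : ∀ x y, y ∈ W → G.Adj x y → x ∈ (Finset.range (s - 1)).image p →
        x ∈ (Finset.range s).image p ∧ y ∈ (Finset.range s).image p := by
      intro x y hy hxy hx
      simp only [Finset.mem_image, Finset.mem_range] at hx
      obtain ⟨a, ha, rfl⟩ := hx
      obtain ⟨b, hb, rfl⟩ := hclosed a ha y hy hxy
      exact ⟨Finset.mem_image_of_mem _ (by simp; omega),
        Finset.mem_image_of_mem _ (by simp; omega)⟩
    intro x y hx hy hxy h
    rw [Finset.mem_offDiag]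
    rcases h with h | h
    · have := key x y hy hxy h
      exact ⟨this.1, this.2, hxy.ne⟩
    · have := key y x hx hxy.symm h
      exact ⟨this.2, this.1, hxy.ne⟩

open Classical in
theorem card_prs {V : Type*} [Fintype V] (G : SimpleGraph V) (S : Set V) :
    (prs G S.toFinset).card = 2 * (G.induce S).edgeSet.ncard := by
  have h1 : (G.induce S).edgeSet.ncard = (G.induce S).edgeFinset.card := by
    rw [← SimpleGraph.coe_edgeFinset, Set.ncard_coe_finset]
  rw [h1, ← SimpleGraph.dart_card_eq_twice_card_edges, ← Finset.card_univ]
  symm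
  refine Finset.card_bij (fun d _ => ((d.fst : V), (d.snd : V))) ?_ ?_ ?_
  · intro d _
    rw [mem_prs]
    have := d.adj
    simp only [SimpleGraph.comap_adj, Function.Embedding.subtype_apply] at this
    simp [this]
  · intro a _ b _ h
    simp only [Prod.mk.injEq] at h
    apply SimpleGraph.Dart.ext
    exact Prod.ext (Subtype.ext h.1) (Subtype.ext h.2)
  · rintro ⟨x, y⟩ h
    rw [mem_prs] at h
    simp only [Set.mem_toFinset] at h
    exact ⟨⟨(⟨x, h.1.1⟩, ⟨y, h.1.2⟩), h.2⟩, Finset.mem_univ _, rfl⟩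

/-- If `G[N_r(v)]` has average degree at least `2s − 4` (`s ≥ 5` odd), then `G`
contains cycles `C_{2m+1}, C_{2m+3}, …, C_{2m+s}` for some `1 ≤ m ≤ r`. -/
theorem cycles_from_dense_sphere {V : Type*} [Fintype V] (G : SimpleGraph V)
    (v : V) (r s : ℕ) (hr : 1 ≤ r) (hs : 5 ≤ s) (hodd : Odd s)
    (hne : (distSphere G v r).Nonempty)
    (hdense : (2 * s - 4) * (distSphere G v r).ncard ≤
      2 * (G.induce (distSphere G v r)).edgeSet.ncard) :
    ∃ m : ℕ, 1 ≤ m ∧ m ≤ r ∧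
      ∀ j : ℕ, Odd j → 1 ≤ j → j ≤ s → HasCycleLength G (2 * m + j) := by
  classical
  obtain ⟨n, c, t, hsn, hth⟩ := theta_of_dense G (distSphere G v r).toFinset s hs
    (by simpa using hne) (by
      rw [card_prs, ← Set.ncard_eq_toFinset_card']
      rwa [show 2 * (s - 2) = 2 * s - 4 by omega])
  rw [Set.coe_toFinset] at hth
  obtain ⟨par, hpar⟩ := exists_par G v
  obtain ⟨hA, hB⟩ := hpar r
  have hex : ∃ m, ∀ i, par^[m] (c i) = par^[m] (c 0) := by
    have : ∀ i, par^[r] (c i) = v := by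
      intro i
      have := hA _ r (hth.mem i) le_rfl
      rw [Nat.sub_self] at this
      exact (this.1.dist_eq_zero_iff.1 this.2).symm
    exact ⟨r, fun i => by rw [this, this]⟩
  have hexr : ∀ i, par^[r] (c i) = par^[r] (c 0) := by
    have : ∀ i, par^[r] (c i) = v := by
      intro i
      have := hA _ r (hth.mem i) le_rfl
      rw [Nat.sub_self] at this
      exact (this.1.dist_eq_zero_iff.1 this.2).symm
    exact fun i => by rw [this, this]
  obtain ⟨m, hm, hmr, hmin⟩ : ∃ m, (∀ i, par^[m] (c i) = par^[m] (c 0)) ∧ m ≤ r ∧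
      ∀ k < m, ¬ ∀ i, par^[k] (c i) = par^[k] (c 0) :=
    ⟨Nat.find hex, Nat.find_spec hex, Nat.find_min' hex hexr, fun k hk => Nat.find_min hex hk⟩
  have hm1 : 1 ≤ m := by
    rcases Nat.eq_zero_or_pos m with h | h
    · subst h
      have h1 := hm 1
      have h2 := hth.adj 0
      simp at h1 h2
      exact absurd h1.symm h2.ne
    · exact h
  refine ⟨m, hm1, hmr, fun j hjo hj1 hjs => ?_⟩
  by_contra hcon
  -- restrict to the vertex set of the cycle
  have hth' : IsTheta G (Set.range c) c n t :=
    ⟨fun i => ⟨i, rfl⟩, hth.inj, hth.adj, hth.chord, hth.two_le, hth.le_n⟩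
  apply hmin (m - 1) (by omega)
  refine hth'.const j hj1 (by omega) hjo (par^[m-1]) ?_
  intro g hg
  by_contra hgne
  apply hcon
  refine glue G v r m j hm1 hmr hj1 par (fun x k hx hk => (hA x k hx hk).2) hB g
    ⟨?_, hg.2.1, hg.2.2⟩ ?_ hgne
  · intro i hi
    obtain ⟨a, ha⟩ := hg.1 i hi
    rw [← ha]; exact hth.mem a
  · obtain ⟨a, ha⟩ := hg.1 0 (by omega)
    obtain ⟨b, hb⟩ := hg.1 j le_rfl
    rw [← ha, ← hb, hm a, hm b]
end
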